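/- Under the Gaussian box-decomposition setup, for every m, the conditional variance (1/W)·∫ (y m)²·1_{f ∈ D} dP − ((1/W)·∫ (y m)·1_{f ∈ D} dP)² equals s m + σ m − (s m / W) · ( Σ_{j=1}^J W[j]·V[j,m]/W[j,m] + (1/W)·( Σ_{j=1}^J W[j]·G[j,m]/W[j,m] )² ). -/

import Mathlib

open MeasureTheory ProbabilityTheory

noncomputable section

/-- The density of the standard normal distribution. -/
def stdPdf (z : ℝ) : ℝ := (Real.sqrt (2 * Real.pi))⁻¹ * Real.exp (-z ^ 2 / 2)

/-- The cumulative distribution function of the standard normal distribution. -/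
def stdCdf (x : ℝ) : ℝ := ∫ z in Set.Iic x, stdPdf z

/-- The standardization map `γ m c = (c − μ m)/√(s m)`. -/
def gam {M : ℕ} (μ s : Fin M → ℝ) (m : Fin M) (c : ℝ) : ℝ :=
  (c - μ m) / Real.sqrt (s m)

/-- `W[j,m] = Φ(γ m (u j m)) − Φ(γ m (l j m))`. -/
def Wjm {M J : ℕ} (μ s : Fin M → ℝ) (l u : Fin J → Fin M → ℝ) (j : Fin J) (m : Fin M) : ℝ :=
  stdCdf (gam μ s m (u j m)) - stdCdf (gam μ s m (l j m))

/-- `W[j] = ∏_m W[j,m]`. -/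
def Wj {M J : ℕ} (μ s : Fin M → ℝ) (l u : Fin J → Fin M → ℝ) (j : Fin J) : ℝ :=
  ∏ m, Wjm μ s l u j m

/-- `W = Σ_j W[j]`. -/
def Wtot {M J : ℕ} (μ s : Fin M → ℝ) (l u : Fin J → Fin M → ℝ) : ℝ :=
  ∑ j, Wj μ s l u j

/-- `G[j,m] = φ(γ m (u j m)) − φ(γ m (l j m))`. -/
def Gjm {M J : ℕ} (μ s : Fin M → ℝ) (l u : Fin J → Fin M → ℝ) (j : Fin J) (m : Fin M) : ℝ :=
  stdPdf (gam μ s m (u j m)) - stdPdf (gam μ s m (l j m))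

/-- `V[j,m] = γ m (u j m)·φ(γ m (u j m)) − γ m (l j m)·φ(γ m (l j m))`. -/
def Vjm {M J : ℕ} (μ s : Fin M → ℝ) (l u : Fin J → Fin M → ℝ) (j : Fin J) (m : Fin M) : ℝ :=
  gam μ s m (u j m) * stdPdf (gam μ s m (u j m))
    - gam μ s m (l j m) * stdPdf (gam μ s m (l j m))

/-- `ρ m = √(s m / (s m + σ m))`. -/
def rho {M : ℕ} (s σ : Fin M → ℝ) (m : Fin M) : ℝ := Real.sqrt (s m / (s m + σ m))

/-- The union `D = ⋃_j B j` of the boxes `B j`. -/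
def boxD {M J : ℕ} (l u : Fin J → Fin M → ℝ) : Set (Fin M → ℝ) :=
  ⋃ j, {z : Fin M → ℝ | ∀ m, l j m < z m ∧ z m ≤ u j m}

/-- The joint law of `(f, ε)`: the product of the two product Gaussian measures
`⨂_m N(μ m, s m)` and `⨂_m N(0, σ m)`. -/
def Pmeas {M : ℕ} (μ s σ : Fin M → ℝ) : Measure ((Fin M → ℝ) × (Fin M → ℝ)) :=
  (Measure.pi fun m => gaussianReal (μ m) (s m).toNNReal).prod
    (Measure.pi fun m => gaussianReal 0 (σ m).toNNReal)

end

lemma hasDerivAt_stdPdf (z : ℝ) : HasDerivAt stdPdf (-(z * stdPdf z)) z := by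
  have h : HasDerivAt (fun z : ℝ => -z ^ 2 / 2) (-z) z := by
    have := ((hasDerivAt_id z).pow 2).neg.div_const 2
    convert! this using 1
    simp
    ring
  convert! h.exp.const_mul (Real.sqrt (2 * Real.pi))⁻¹ using 1
  simp only [stdPdf]
  ring

@[fun_prop]
lemma continuous_stdPdf : Continuous stdPdf :=
  continuous_iff_continuousAt.2 fun z => (hasDerivAt_stdPdf z).continuousAt

lemma stdPdf_pos (z : ℝ) : 0 < stdPdf z := by
  unfold stdPdf
  positivity

lemma stdPdf_eq_gaussianPDFReal : stdPdf = gaussianPDFReal 0 1 := by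
  ext z
  simp [stdPdf, gaussianPDFReal]

lemma intervalIntegral_stdPdf (a b : ℝ) : ∫ z in a..b, stdPdf z = stdCdf b - stdCdf a := by
  have h : Integrable stdPdf := stdPdf_eq_gaussianPDFReal ▸ integrable_gaussianPDFReal 0 1
  exact (intervalIntegral.integral_Iic_sub_Iic h.integrableOn h.integrableOn).symm

lemma intervalIntegral_mul_stdPdf (a b : ℝ) :
    ∫ z in a..b, z * stdPdf z = -(stdPdf b - stdPdf a) := by
  have h := intervalIntegral.integral_eq_sub_of_hasDerivAt (a := a) (b := b)
    (fun z _ => (hasDerivAt_stdPdf z).neg)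
    (Continuous.intervalIntegrable (by fun_prop) a b)
  simp only [neg_neg, Pi.neg_apply] at h
  rw [h]
  ring

lemma intervalIntegral_sq_mul_stdPdf (a b : ℝ) :
    ∫ z in a..b, z ^ 2 * stdPdf z
      = (stdCdf b - stdCdf a) - (b * stdPdf b - a * stdPdf a) := by
  have h := intervalIntegral.integral_eq_sub_of_hasDerivAt (a := a) (b := b)
    (fun z _ => (hasDerivAt_id z).mul (hasDerivAt_stdPdf z))
    (Continuous.intervalIntegrable (by simp only [id]; fun_prop) a b)
  simp only [Pi.mul_apply, id] at h
  rw [← h, ← intervalIntegral_stdPdf, ← intervalIntegral.integral_sub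
    (Continuous.intervalIntegrable (by fun_prop) a b)
    (Continuous.intervalIntegrable (by fun_prop) a b)]
  congr 1
  ext z
  ring

lemma gaussianReal_eq_map_std (μ : ℝ) {s : ℝ} (hs : 0 < s) :
    gaussianReal μ s.toNNReal = (gaussianReal 0 1).map fun z => Real.sqrt s * z + μ := by
  have h := Measure.map_map (μ := gaussianReal 0 1) (g := fun z => z + μ)
    (f := fun z => Real.sqrt s * z) (by fun_prop) (by fun_prop)
  rw [Function.comp_def] at h
  rw [← h, gaussianReal_map_const_mul, gaussianReal_map_add_const]
  congr 1
  · simp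
  · ext
    simp [Real.sq_sqrt hs.le, hs.le]

/-- Truncated Gaussian integrals as integrals against the standard normal density. -/
lemma setIntegral_Ioc_gaussianReal (μ : ℝ) {s : ℝ} (hs : 0 < s) {a b : ℝ} (hab : a ≤ b)
    {g : ℝ → ℝ} (hg : Continuous g) :
    ∫ x in Set.Ioc a b, g x ∂gaussianReal μ s.toNNReal
      = ∫ z in ((a - μ) / Real.sqrt s)..((b - μ) / Real.sqrt s),
          g (Real.sqrt s * z + μ) * stdPdf z := by
  have hr : 0 < Real.sqrt s := Real.sqrt_pos.2 hs
  have hpre : (fun z => Real.sqrt s * z + μ) ⁻¹' Set.Ioc a b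
      = Set.Ioc ((a - μ) / Real.sqrt s) ((b - μ) / Real.sqrt s) := by
    ext z
    simp only [Set.mem_preimage, Set.mem_Ioc, div_lt_iff₀ hr, le_div_iff₀ hr]
    constructor <;> rintro ⟨h₁, h₂⟩ <;> constructor <;> linarith
  rw [gaussianReal_eq_map_std μ hs, setIntegral_map measurableSet_Ioc
    hg.aestronglyMeasurable (by fun_prop), hpre, ← integral_indicator measurableSet_Ioc,
    integral_gaussianReal_eq_integral_smul one_ne_zero,
    intervalIntegral.integral_of_le (by gcongr), ← integral_indicator measurableSet_Ioc,
    ← stdPdf_eq_gaussianPDFReal]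
  congr 1
  ext z
  by_cases hz : z ∈ Set.Ioc ((a - μ) / Real.sqrt s) ((b - μ) / Real.sqrt s)
  · simp [Set.indicator_of_mem hz, mul_comm]
  · simp [Set.indicator_of_notMem hz]

lemma setIntegral_Ioc_one_gaussianReal (μ : ℝ) {s : ℝ} (hs : 0 < s) {a b : ℝ} (hab : a ≤ b) :
    ∫ _ in Set.Ioc a b, (1 : ℝ) ∂gaussianReal μ s.toNNReal
      = stdCdf ((b - μ) / Real.sqrt s) - stdCdf ((a - μ) / Real.sqrt s) := by
  rw [setIntegral_Ioc_gaussianReal μ hs hab continuous_const, ← intervalIntegral_stdPdf]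
  simp

lemma setIntegral_Ioc_id_gaussianReal (μ : ℝ) {s : ℝ} (hs : 0 < s) {a b : ℝ} (hab : a ≤ b) :
    ∫ x in Set.Ioc a b, x ∂gaussianReal μ s.toNNReal
      = μ * (stdCdf ((b - μ) / Real.sqrt s) - stdCdf ((a - μ) / Real.sqrt s))
        - Real.sqrt s * (stdPdf ((b - μ) / Real.sqrt s) - stdPdf ((a - μ) / Real.sqrt s)) := by
  rw [setIntegral_Ioc_gaussianReal μ hs hab (g := fun x => x) continuous_id]
  simp only [add_mul, mul_assoc]
  rw [intervalIntegral.integral_add (Continuous.intervalIntegrable (by fun_prop) _ _)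
      (Continuous.intervalIntegrable (by fun_prop) _ _)]
  simp only [intervalIntegral.integral_const_mul, intervalIntegral_stdPdf,
    intervalIntegral_mul_stdPdf]
  ring

lemma setIntegral_Ioc_sq_gaussianReal (μ : ℝ) {s : ℝ} (hs : 0 < s) {a b : ℝ} (hab : a ≤ b) :
    ∫ x in Set.Ioc a b, x ^ 2 ∂gaussianReal μ s.toNNReal
      = (μ ^ 2 + s) * (stdCdf ((b - μ) / Real.sqrt s) - stdCdf ((a - μ) / Real.sqrt s))
        - 2 * μ * Real.sqrt s
          * (stdPdf ((b - μ) / Real.sqrt s) - stdPdf ((a - μ) / Real.sqrt s))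
        - s * ((b - μ) / Real.sqrt s * stdPdf ((b - μ) / Real.sqrt s)
          - (a - μ) / Real.sqrt s * stdPdf ((a - μ) / Real.sqrt s)) := by
  rw [setIntegral_Ioc_gaussianReal μ hs hab (g := fun x => x ^ 2) (by fun_prop)]
  have key : ∀ z : ℝ, (Real.sqrt s * z + μ) ^ 2 * stdPdf z
      = s * (z ^ 2 * stdPdf z) + 2 * μ * Real.sqrt s * (z * stdPdf z) + μ ^ 2 * stdPdf z := by
    intro z
    linear_combination z ^ 2 * stdPdf z * Real.sq_sqrt hs.le
  simp only [key]
  rw [intervalIntegral.integral_add (Continuous.intervalIntegrable (by fun_prop) _ _)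
      (Continuous.intervalIntegrable (by fun_prop) _ _),
    intervalIntegral.integral_add (Continuous.intervalIntegrable (by fun_prop) _ _)
      (Continuous.intervalIntegrable (by fun_prop) _ _)]
  simp only [intervalIntegral.integral_const_mul, intervalIntegral_stdPdf,
    intervalIntegral_mul_stdPdf, intervalIntegral_sq_mul_stdPdf]
  ring

/-- Integral over a box, against a product measure, of a function of one coordinate. -/
lemma setIntegral_univ_pi_comp_eval {ι : Type*} [Fintype ι] [DecidableEq ι] {X : ι → Type*}
    [∀ i, MeasurableSpace (X i)] (ν : ∀ i, Measure (X i)) [∀ i, SigmaFinite (ν i)]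
    (S : ∀ i, Set (X i)) (m : ι) (g : X m → ℝ) :
    ∫ x in Set.univ.pi S, g (x m) ∂Measure.pi ν
      = (∏ i ∈ Finset.univ.erase m, ∫ _ in S i, (1 : ℝ) ∂ν i) * ∫ x in S m, g x ∂ν m := by
  have hx : ∀ x : ∀ i, X i,
      g (x m) = ∏ i, (if h : i = m then (h ▸ g : X i → ℝ) else fun _ => 1) (x i) := by
    intro x
    rw [← Finset.mul_prod_erase _ _ (Finset.mem_univ m), Finset.prod_eq_one]
    · simp
    · intro i hi
      simp [Finset.ne_of_mem_erase hi]
  simp only [hx]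
  rw [Measure.restrict_pi_pi, integral_fintype_prod_eq_prod
    (fun i => if h : i = m then (h ▸ g : X i → ℝ) else fun _ => 1),
    ← Finset.mul_prod_erase _ _ (Finset.mem_univ m), mul_comm]
  congr 1
  · refine Finset.prod_congr rfl fun i hi => ?_
    simp [Finset.ne_of_mem_erase hi]
  · simp

lemma box_eq_univ_pi {ι : Type*} (a b : ι → ℝ) :
    {z : ι → ℝ | ∀ m, a m < z m ∧ z m ≤ b m} = Set.univ.pi fun m => Set.Ioc (a m) (b m) := by
  ext z
  simp [Set.mem_pi]

lemma measurableSet_box {ι : Type*} [Countable ι] (a b : ι → ℝ) :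
    MeasurableSet {z : ι → ℝ | ∀ m, a m < z m ∧ z m ≤ b m} :=
  box_eq_univ_pi a b ▸ MeasurableSet.univ_pi fun _ => measurableSet_Ioc

lemma measurableSet_boxD {M J : ℕ} (l u : Fin J → Fin M → ℝ) : MeasurableSet (boxD l u) :=
  MeasurableSet.iUnion fun j => measurableSet_box (l j) (u j)

lemma Wjm_pos {M J : ℕ} {μ s : Fin M → ℝ} (hs : ∀ m, 0 < s m) {l u : Fin J → Fin M → ℝ}
    (hlu : ∀ j m, l j m < u j m) (j : Fin J) (m : Fin M) : 0 < Wjm μ s l u j m := by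
  rw [Wjm, ← intervalIntegral_stdPdf]
  refine intervalIntegral.intervalIntegral_pos_of_pos
    (continuous_stdPdf.intervalIntegrable _ _) stdPdf_pos ?_
  exact div_lt_div_of_pos_right (sub_lt_sub_right (hlu j m) _) (Real.sqrt_pos.2 (hs m))

lemma Wj_pos {M J : ℕ} {μ s : Fin M → ℝ} (hs : ∀ m, 0 < s m) {l u : Fin J → Fin M → ℝ}
    (hlu : ∀ j m, l j m < u j m) (j : Fin J) : 0 < Wj μ s l u j :=
  Finset.prod_pos fun m _ => Wjm_pos hs hlu j m

/-- Integral over the union of disjoint boxes of a function of one coordinate. -/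
lemma setIntegral_boxD_comp_eval {M J : ℕ} {μ s : Fin M → ℝ} (hs : ∀ m, 0 < s m)
    {l u : Fin J → Fin M → ℝ} (hlu : ∀ j m, l j m < u j m)
    (hdisj : Pairwise fun j j' : Fin J => Disjoint
        {z : Fin M → ℝ | ∀ m, l j m < z m ∧ z m ≤ u j m}
        {z : Fin M → ℝ | ∀ m, l j' m < z m ∧ z m ≤ u j' m})
    (m : Fin M) {g : ℝ → ℝ} (hg : Integrable g (gaussianReal (μ m) (s m).toNNReal)) :
    ∫ x in boxD l u, g (x m) ∂(Measure.pi fun m => gaussianReal (μ m) (s m).toNNReal)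
      = ∑ j, Wj μ s l u j / Wjm μ s l u j m
          * ∫ x in Set.Ioc (l j m) (u j m), g x ∂gaussianReal (μ m) (s m).toNNReal := by
  rw [boxD, integral_iUnion_fintype (fun j => measurableSet_box (l j) (u j)) hdisj
    fun j => (integrable_comp_eval (μ := fun m => gaussianReal (μ m) (s m).toNNReal)
      hg).integrableOn]
  refine Finset.sum_congr rfl fun j _ => ?_
  rw [box_eq_univ_pi, setIntegral_univ_pi_comp_eval]
  congr 1
  rw [eq_div_iff (Wjm_pos hs hlu j m).ne', Wj, ← Finset.prod_erase_mul _ _ (Finset.mem_univ m)]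
  congr 1
  exact Finset.prod_congr rfl fun i _ =>
    setIntegral_Ioc_one_gaussianReal (μ i) (hs i) (hlu j i).le

lemma integrable_pow_gaussianReal (μ : ℝ) (v : NNReal) (k : ℕ) :
    Integrable (fun x => x ^ k) (gaussianReal μ v) := by
  have h := (memLp_id_gaussianReal (μ := μ) (v := v) k).integrable_norm_pow'
  refine h.mono' (by fun_prop) (ae_of_all _ fun x => ?_)
  simp

lemma integral_sq_gaussianReal_zero (v : NNReal) : ∫ x, x ^ 2 ∂gaussianReal 0 v = v := by
  have h := variance_fun_id_gaussianReal (μ := 0) (v := v)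
  rwa [variance_of_integral_eq_zero (by fun_prop) integral_id_gaussianReal] at h

section Noise

variable {Ω Ω' : Type*} [MeasurableSpace Ω] [MeasurableSpace Ω'] {P : Measure Ω} {Q : Measure Ω'}
  [IsFiniteMeasure P] [IsProbabilityMeasure Q] {X : Ω → ℝ} {N : Ω' → ℝ} {D : Set Ω}

/-- Adding independent centred noise does not change the first moment on an event. -/
lemma integral_add_noise_mul_indicator (hD : MeasurableSet D) (hX : Integrable X P)
    (hN : Integrable N Q) (hN₀ : ∫ e, N e ∂Q = 0) :
    ∫ p, (X p.1 + N p.2) * D.indicator (fun _ => (1 : ℝ)) p.1 ∂P.prod Q = ∫ x in D, X x ∂P := by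
  have h₁ : Integrable (D.indicator fun _ => (1 : ℝ)) P := (integrable_const 1).indicator hD
  have key : ∀ p : Ω × Ω', (X p.1 + N p.2) * D.indicator (fun _ => (1 : ℝ)) p.1
      = D.indicator X p.1 * 1 + D.indicator (fun _ => (1 : ℝ)) p.1 * N p.2 := by
    intro p
    by_cases hp : p.1 ∈ D <;> simp [hp]
  simp only [key]
  rw [integral_add ((hX.indicator hD).mul_prod (integrable_const 1)) (h₁.mul_prod hN),
    integral_prod_mul (D.indicator X) fun _ => 1, integral_prod_mul _ N, hN₀,
    integral_indicator hD]
  simp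

/-- Adding independent centred noise adds its variance, times the probability of the event, to
the second moment on an event. -/
lemma integral_add_noise_sq_mul_indicator (hD : MeasurableSet D) (hX : Integrable X P)
    (hX₂ : Integrable (fun x => X x ^ 2) P) (hN : Integrable N Q)
    (hN₂ : Integrable (fun e => N e ^ 2) Q) (hN₀ : ∫ e, N e ∂Q = 0) :
    ∫ p, (X p.1 + N p.2) ^ 2 * D.indicator (fun _ => (1 : ℝ)) p.1 ∂P.prod Q
      = ∫ x in D, X x ^ 2 ∂P + (∫ _ in D, (1 : ℝ) ∂P) * ∫ e, N e ^ 2 ∂Q := by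
  have h₁ : Integrable (D.indicator fun _ => (1 : ℝ)) P := (integrable_const 1).indicator hD
  have key : ∀ p : Ω × Ω', (X p.1 + N p.2) ^ 2 * D.indicator (fun _ => (1 : ℝ)) p.1
      = D.indicator (fun x => X x ^ 2) p.1 * 1 + D.indicator X p.1 * (2 * N p.2)
        + D.indicator (fun _ => (1 : ℝ)) p.1 * N p.2 ^ 2 := by
    intro p
    by_cases hp : p.1 ∈ D
    · simp only [hp, Set.indicator_of_mem]
      ring
    · simp [hp]
  simp only [key]
  have i₁ := (hX₂.indicator hD).mul_prod (integrable_const (μ := Q) (1 : ℝ))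
  have i₂ := (hX.indicator hD).mul_prod (hN.const_mul 2)
  rw [integral_add (by exact i₁.add i₂) (h₁.mul_prod hN₂), integral_add i₁ i₂,
    integral_prod_mul (D.indicator fun x => X x ^ 2) fun _ => 1,
    integral_prod_mul (D.indicator X) fun e => 2 * N e,
    integral_prod_mul _ fun e => N e ^ 2, integral_const_mul, hN₀,
    integral_indicator hD, integral_indicator hD, integral_indicator hD]
  simp

end Noise

/-- Conditional variance formula. -/
theorem conditional_variance
    (M J : ℕ) (hM : 1 ≤ M) (hJ : 1 ≤ J)
    (μ s σ : Fin M → ℝ) (hs : ∀ m, 0 < s m) (hσ : ∀ m, 0 ≤ σ m)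
    (l u : Fin J → Fin M → ℝ) (hlu : ∀ j m, l j m < u j m)
    (hdisj : Pairwise fun j j' : Fin J => Disjoint
        {z : Fin M → ℝ | ∀ m, l j m < z m ∧ z m ≤ u j m}
        {z : Fin M → ℝ | ∀ m, l j' m < z m ∧ z m ≤ u j' m})
    (m : Fin M) :
    (1 / Wtot μ s l u) * (∫ p, (p.1 m + p.2 m) ^ 2
          * Set.indicator (boxD l u) (fun _ => (1 : ℝ)) p.1 ∂(Pmeas μ s σ))
      - ((1 / Wtot μ s l u) * ∫ p, (p.1 m + p.2 m)
            * Set.indicator (boxD l u) (fun _ => (1 : ℝ)) p.1 ∂(Pmeas μ s σ)) ^ 2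
      = s m + σ m - (s m / Wtot μ s l u)
          * ((∑ j, Wj μ s l u j * (Vjm μ s l u j m / Wjm μ s l u j m))
              + (1 / Wtot μ s l u)
                * (∑ j, Wj μ s l u j * (Gjm μ s l u j m / Wjm μ s l u j m)) ^ 2) := by
  let ν : Fin M → Measure ℝ := fun m => gaussianReal (μ m) (s m).toNNReal
  let κ : Fin M → Measure ℝ := fun m => gaussianReal 0 (σ m).toNNReal
  have hW : 0 < Wtot μ s l u := Finset.sum_pos (fun j _ => Wj_pos hs hlu j)
    ⟨⟨0, hJ⟩, Finset.mem_univ _⟩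
  have hν : ∀ k : ℕ, Integrable (fun x : Fin M → ℝ => x m ^ k) (Measure.pi ν) := fun k =>
    integrable_comp_eval (μ := ν) (i := m) (f := fun x : ℝ => x ^ k)
      (integrable_pow_gaussianReal _ _ k)
  have hκ : ∀ k : ℕ, Integrable (fun x : Fin M → ℝ => x m ^ k) (Measure.pi κ) := fun k =>
    integrable_comp_eval (μ := κ) (i := m) (f := fun x : ℝ => x ^ k)
      (integrable_pow_gaussianReal _ _ k)
  have hκ₁ : ∫ e, e m ∂Measure.pi κ = 0 :=
    (integral_comp_eval (μ := κ) (f := fun x : ℝ => x) (by fun_prop)).trans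
      integral_id_gaussianReal
  have hκ₂ : ∫ e, e m ^ 2 ∂Measure.pi κ = σ m := by
    rw [integral_comp_eval (μ := κ) (f := fun x : ℝ => x ^ 2) (by fun_prop),
      integral_sq_gaussianReal_zero, Real.coe_toNNReal _ (hσ m)]
  set A := ∑ j, Wj μ s l u j * (Vjm μ s l u j m / Wjm μ s l u j m) with hA
  set B := ∑ j, Wj μ s l u j * (Gjm μ s l u j m / Wjm μ s l u j m) with hB
  have hD₀ : ∫ _ in boxD l u, (1 : ℝ) ∂Measure.pi ν = Wtot μ s l u := by
    rw [setIntegral_boxD_comp_eval hs hlu hdisj m (g := fun _ => 1) (integrable_const 1), Wtot]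
    refine Finset.sum_congr rfl fun j _ => ?_
    rw [setIntegral_Ioc_one_gaussianReal _ (hs m) (hlu j m).le]
    exact div_mul_cancel₀ _ (Wjm_pos hs hlu j m).ne'
  have hD₁ : ∫ x in boxD l u, x m ∂Measure.pi ν
      = μ m * Wtot μ s l u - Real.sqrt (s m) * B := by
    rw [setIntegral_boxD_comp_eval hs hlu hdisj m (g := fun x => x)
      (by simpa using integrable_pow_gaussianReal (μ m) (s m).toNNReal 1), Wtot, hB,
      Finset.mul_sum, Finset.mul_sum, ← Finset.sum_sub_distrib]
    refine Finset.sum_congr rfl fun j _ => ?_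
    have hj := (Wjm_pos (μ := μ) hs hlu j m).ne'
    rw [setIntegral_Ioc_id_gaussianReal _ (hs m) (hlu j m).le]
    change _ / _ * (μ m * Wjm μ s l u j m - Real.sqrt (s m) * Gjm μ s l u j m) = _
    field_simp
  have hD₂ : ∫ x in boxD l u, x m ^ 2 ∂Measure.pi ν
      = (μ m ^ 2 + s m) * Wtot μ s l u - 2 * μ m * Real.sqrt (s m) * B - s m * A := by
    rw [setIntegral_boxD_comp_eval hs hlu hdisj m (g := fun x => x ^ 2)
      (integrable_pow_gaussianReal (μ m) (s m).toNNReal 2), Wtot, hA, hB,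
      Finset.mul_sum, Finset.mul_sum, Finset.mul_sum, ← Finset.sum_sub_distrib,
      ← Finset.sum_sub_distrib]
    refine Finset.sum_congr rfl fun j _ => ?_
    have hj := (Wjm_pos (μ := μ) hs hlu j m).ne'
    rw [setIntegral_Ioc_sq_gaussianReal _ (hs m) (hlu j m).le]
    change _ / _ * ((μ m ^ 2 + s m) * Wjm μ s l u j m
      - 2 * μ m * Real.sqrt (s m) * Gjm μ s l u j m - s m * Vjm μ s l u j m) = _
    field_simp
  have hD := measurableSet_boxD l u
  rw [show Pmeas μ s σ = (Measure.pi ν).prod (Measure.pi κ) from rfl,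
    integral_add_noise_sq_mul_indicator (X := fun x : Fin M → ℝ => x m)
      (N := fun x : Fin M → ℝ => x m) hD (by simpa using hν 1) (hν 2) (by simpa using hκ 1)
      (hκ 2) hκ₁,
    integral_add_noise_mul_indicator (X := fun x : Fin M → ℝ => x m)
      (N := fun x : Fin M → ℝ => x m) hD (by simpa using hν 1) (by simpa using hκ 1) hκ₁,
    hκ₂, hD₀, hD₁, hD₂]
  have hs₂ := Real.sq_sqrt (hs m).le
  have hW' := hW.ne'
  field_simp
  linear_combination (-B ^ 2) * hs₂
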